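/- Let S ⊆ ℝⁿ and T ⊆ S be sets such that the ring B(S) of polynomials bounded on S is Noetherian and B(S) ≠ B(T). Let I = {p ∈ ℝ[x₁,…,xₙ] : p(x) = 0 for all x ∈ S \ T} be the vanishing ideal of S \ T. Then for every m and every family b₁, …, b_m of elements of B(T) that is algebraically independent over ℝ, one has m ≤ Krull dimension of the quotient ring ℝ[x₁,…,xₙ]/I. -/

import Mathlib

/-- The `ℝ`-subalgebra `B(S)` of `ℝ[x₁,…,xₙ]` consisting of the polynomials whose
image on `S ⊆ ℝⁿ` is a bounded subset of `ℝ`. -/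
noncomputable def polyBdd (n : ℕ) (S : Set (Fin n → ℝ)) :
    Subalgebra ℝ (MvPolynomial (Fin n) ℝ) where
  carrier := {f | Bornology.IsBounded ((fun x => MvPolynomial.eval x f) '' S)}
  add_mem' := by
    intro a b ha hb
    rw [Set.mem_setOf_eq, isBounded_iff_forall_norm_le] at *
    obtain ⟨Ca, hCa⟩ := ha
    obtain ⟨Cb, hCb⟩ := hb
    refine ⟨Ca + Cb, ?_⟩
    rintro _ ⟨x, hx, rfl⟩
    simp only [map_add]
    calc ‖MvPolynomial.eval x a + MvPolynomial.eval x b‖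
        ≤ ‖MvPolynomial.eval x a‖ + ‖MvPolynomial.eval x b‖ := norm_add_le _ _
      _ ≤ Ca + Cb := add_le_add (hCa _ ⟨x, hx, rfl⟩) (hCb _ ⟨x, hx, rfl⟩)
  mul_mem' := by
    intro a b ha hb
    rw [Set.mem_setOf_eq, isBounded_iff_forall_norm_le] at *
    obtain ⟨Ca, hCa⟩ := ha
    obtain ⟨Cb, hCb⟩ := hb
    refine ⟨max Ca 0 * max Cb 0, ?_⟩
    rintro _ ⟨x, hx, rfl⟩
    simp only [map_mul, norm_mul]
    exact mul_le_mul (le_max_of_le_left (hCa _ ⟨x, hx, rfl⟩))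
      (le_max_of_le_left (hCb _ ⟨x, hx, rfl⟩)) (norm_nonneg _) (le_max_right _ _)
  zero_mem' := by
    rw [Set.mem_setOf_eq, isBounded_iff_forall_norm_le]
    exact ⟨0, by rintro _ ⟨x, hx, rfl⟩; simp⟩
  one_mem' := by
    rw [Set.mem_setOf_eq, isBounded_iff_forall_norm_le]
    exact ⟨1, by rintro _ ⟨x, hx, rfl⟩; simp⟩
  algebraMap_mem' := by
    intro r
    rw [Set.mem_setOf_eq, isBounded_iff_forall_norm_le]
    refine ⟨‖r‖, ?_⟩
    rintro _ ⟨x, hx, rfl⟩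
    simp [MvPolynomial.algebraMap_eq]

/-- An integral extension of rings does not lower the Krull dimension of the base. -/
theorem ringKrullDim_le_of_isIntegral_of_injective {R S : Type*} [CommRing R] [CommRing S]
    [Algebra R S] [Algebra.IsIntegral R S] (hinj : Function.Injective (algebraMap R S)) :
    ringKrullDim R ≤ ringKrullDim S := by
  refine iSup_le fun l => ?_
  obtain ⟨P, -, hP, hPl⟩ := Ideal.exists_ideal_over_prime_of_isIntegral
    l.head.asIdeal (⊥ : Ideal S) (by simp [Ideal.comap_bot_of_injective _ hinj])
  have : P.LiesOver l.head.asIdeal := ⟨hPl.symm⟩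
  obtain ⟨L, hL, -, -⟩ := Ideal.exists_ltSeries_of_hasGoingUp l P
  rw [← hL]
  exact le_iSup (fun L : LTSeries (PrimeSpectrum S) => (L.length : WithBot ℕ∞)) L

/-- In a finitely generated domain over a field, the size of an algebraically independent family
is at most the Krull dimension. -/
theorem AlgebraicIndependent.natCast_le_ringKrullDim_of_isDomain {k A : Type*} [Field k]
    [CommRing A] [IsDomain A] [Algebra k A] [Algebra.FiniteType k A] {m : ℕ} {b : Fin m → A}
    (hb : AlgebraicIndependent k b) : (m : WithBot ℕ∞) ≤ ringKrullDim A := by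
  obtain ⟨s, g, hinj, hint⟩ := exists_integral_inj_algHom_of_fg k A
  let := g.toRingHom.toAlgebra
  have : IsScalarTower k (MvPolynomial (Fin s) k) A := .of_algebraMap_eq fun r => (g.commutes r).symm
  have : Algebra.IsIntegral (MvPolynomial (Fin s) k) A := ⟨hint⟩
  have : FaithfulSMul (MvPolynomial (Fin s) k) A :=
    (faithfulSMul_iff_algebraMap_injective _ _).mpr hinj
  have hs := ((IsTranscendenceBasis.mvPolynomial (Fin s) k).algebraMap_comp
    (A := A)).lift_cardinalMk_eq_trdeg
  have hm := hb.lift_cardinalMk_le_trdeg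
  rw [← hs] at hm
  have hms : m ≤ s := by simpa using hm
  have hdim : (s : WithBot ℕ∞) ≤ ringKrullDim A := by
    simpa [MvPolynomial.ringKrullDim_of_isNoetherianRing] using
      ringKrullDim_le_of_isIntegral_of_injective (R := MvPolynomial (Fin s) k) (S := A) hinj
  exact le_trans (by exact_mod_cast hms) hdim

/-- In a finitely generated algebra over a field, the size of an algebraically independent family
is at most the Krull dimension. -/
theorem AlgebraicIndependent.natCast_le_ringKrullDim {k A : Type*} [Field k]
    [CommRing A] [Algebra k A] [Algebra.FiniteType k A] {m : ℕ} {b : Fin m → A}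
    (hb : AlgebraicIndependent k b) : (m : WithBot ℕ∞) ≤ ringKrullDim A := by
  obtain ⟨p, hp, hcomap⟩ := Ideal.exists_comap_eq_of_mem_minimalPrimes_of_injective
    (f := (MvPolynomial.aeval b : MvPolynomial (Fin m) k →ₐ[k] A).toRingHom) hb ⊥
    (by simp [IsDomain.minimalPrimes_eq_singleton_bot])
  have hq : AlgebraicIndependent k (fun i => Ideal.Quotient.mkₐ k p (b i)) := by
    rw [algebraicIndependent_iff]
    intro P hP
    rw [← MvPolynomial.comp_aeval_apply] at hP
    have : P ∈ Ideal.comap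
        (MvPolynomial.aeval b : MvPolynomial (Fin m) k →ₐ[k] A).toRingHom p :=
      Ideal.mem_comap.mpr (Ideal.Quotient.eq_zero_iff_mem.mp hP)
    rwa [hcomap] at this
  exact hq.natCast_le_ringKrullDim_of_isDomain.trans
    (ringKrullDim_le_of_surjective _ (Ideal.Quotient.mk_surjective (I := p)))

theorem mem_polyBdd_iff {n : ℕ} {S : Set (Fin n → ℝ)} {f : MvPolynomial (Fin n) ℝ} :
    f ∈ polyBdd n S ↔ ∃ C, ∀ x ∈ S, |MvPolynomial.eval x f| ≤ C := by
  change Bornology.IsBounded ((fun x => MvPolynomial.eval x f) '' S) ↔ _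
  simp [isBounded_iff_forall_norm_le]

theorem polyBdd_anti {n : ℕ} {S T : Set (Fin n → ℝ)} (hTS : T ⊆ S) :
    polyBdd n S ≤ polyBdd n T := fun f hf => by
  rw [mem_polyBdd_iff] at hf ⊢
  exact hf.imp fun C hC x hx => hC x (hTS hx)

/-- A polynomial bounded on `T` and vanishing on `S \ T` is bounded on `S`. -/
theorem mem_polyBdd_of_eval_eq_zero {n : ℕ} {S T : Set (Fin n → ℝ)}
    {f : MvPolynomial (Fin n) ℝ} (hf : f ∈ polyBdd n T)
    (h0 : ∀ x ∈ S \ T, MvPolynomial.eval x f = 0) : f ∈ polyBdd n S := by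
  rw [mem_polyBdd_iff] at hf ⊢
  obtain ⟨C, hC⟩ := hf
  refine ⟨max C 0, fun x hx => ?_⟩
  by_cases hxT : x ∈ T
  · exact le_max_of_le_left (hC x hxT)
  · simp [h0 x ⟨hx, hxT⟩]

/-- If `|a i| ≤ C` for all `i`, a real root of the monic polynomial `t ^ d + ∑ a i * t ^ i`
is bounded in terms of `C` and `d`. -/
theorem abs_le_of_monic_root {d : ℕ} {a : ℕ → ℝ} {t C : ℝ} (hC : 0 ≤ C)
    (ha : ∀ i, |a i| ≤ C) (ht : t ^ d + ∑ i ∈ Finset.range d, a i * t ^ i = 0) :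
    |t| ≤ 1 + d * C := by
  by_contra! hlt
  have h1 : 1 ≤ |t| := by nlinarith [mul_nonneg (Nat.cast_nonneg (α := ℝ) d) hC]
  rcases d with - | d
  · simp at ht
  have hsum : |∑ i ∈ Finset.range (d + 1), a i * t ^ i| ≤ (d + 1 : ℕ) * (C * |t| ^ d) := by
    refine (Finset.abs_sum_le_sum_abs _ _).trans ?_
    rw [← nsmul_eq_mul]
    refine (Finset.sum_le_card_nsmul _ _ (C * |t| ^ d) fun i hi => ?_).trans (by simp)
    rw [abs_mul, abs_pow]
    exact mul_le_mul (ha i) (pow_le_pow_right₀ h1 (by simpa [Nat.lt_succ_iff] using hi))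
      (by positivity) hC
  have heq : |t| ^ (d + 1) = |∑ i ∈ Finset.range (d + 1), a i * t ^ i| := by
    rw [← abs_pow, eq_neg_of_add_eq_zero_left ht, abs_neg]
  have hpos : 0 < |t| ^ d := by positivity
  rw [← heq, pow_succ] at hsum
  nlinarith

/-- The ring of polynomials bounded on `S` is integrally closed in the polynomial ring. -/
theorem mem_polyBdd_of_isIntegral {n : ℕ} {S : Set (Fin n → ℝ)} {f : MvPolynomial (Fin n) ℝ}
    (hf : IsIntegral (polyBdd n S) f) : f ∈ polyBdd n S := by
  obtain ⟨P, hP, hPf⟩ := hf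
  choose C hC using fun i => mem_polyBdd_iff.mp (P.coeff i).2
  rw [mem_polyBdd_iff]
  let K := ∑ i ∈ Finset.range P.natDegree, |C i|
  have hK : 0 ≤ K := Finset.sum_nonneg fun i _ => abs_nonneg _
  refine ⟨1 + P.natDegree * K, fun x hx => ?_⟩
  refine abs_le_of_monic_root (a := fun i => if i < P.natDegree then
    MvPolynomial.eval x (P.coeff i : MvPolynomial (Fin n) ℝ) else 0) hK (fun i => ?_) ?_
  · split_ifs with hi
    · exact (hC i x hx).trans ((le_abs_self _).trans
        (Finset.single_le_sum (f := fun i => |C i|) (fun i _ => abs_nonneg _)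
          (Finset.mem_range.mpr hi)))
    · simpa using hK
  · have h := congrArg (MvPolynomial.eval x) hPf
    rw [Polynomial.eval₂_eq_sum_range, Finset.sum_range_succ, hP.coeff_natDegree] at h
    simp only [map_add, map_sum, map_mul, map_pow, map_one, one_mul, map_zero] at h
    rw [← h, add_comm]
    congr 1
    refine Finset.sum_congr rfl fun i hi => ?_
    rw [if_pos (Finset.mem_range.mp hi)]
    rfl

/-- If `B(S)` is Noetherian and some nonzero `g ∈ B(S)` satisfies `B(T) g ⊆ B(S)`, then
`B(T) ⊆ B(S)`. -/
theorem polyBdd_le_of_mul_mem {n : ℕ} {S T : Set (Fin n → ℝ)} (hTS : T ⊆ S)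
    [IsNoetherianRing (polyBdd n S)] {g : MvPolynomial (Fin n) ℝ} (hg : g ≠ 0)
    (hmul : ∀ f ∈ polyBdd n T, f * g ∈ polyBdd n S) : polyBdd n T ≤ polyBdd n S := by
  intro f hf
  let N : Submodule (polyBdd n S) (MvPolynomial (Fin n) ℝ) :=
    { carrier := {h | ∃ q ∈ polyBdd n T, h = q * g}
      zero_mem' := ⟨0, zero_mem _, by simp⟩
      add_mem' := by
        rintro _ _ ⟨p, hp, rfl⟩ ⟨q, hq, rfl⟩
        exact ⟨p + q, add_mem hp hq, by ring⟩
      smul_mem' := by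
        rintro c _ ⟨q, hq, rfl⟩
        exact ⟨c * q, mul_mem (polyBdd_anti hTS c.2) hq, by
          rw [Subalgebra.smul_def, smul_eq_mul, mul_assoc]⟩ }
  have hle : N ≤ LinearMap.range (Algebra.linearMap (polyBdd n S) (MvPolynomial (Fin n) ℝ)) := by
    rintro _ ⟨q, hq, rfl⟩
    exact ⟨⟨_, hmul q hq⟩, rfl⟩
  have hfg : N.FG := by
    rw [← Submodule.map_comap_eq_self hle]
    exact (IsNoetherian.noetherian _).map _
  refine mem_polyBdd_of_isIntegral (isIntegral_of_smul_mem_submodule N ?_ hfg f ?_)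
  · exact fun h => hg ((Submodule.eq_bot_iff N).mp h g ⟨1, one_mem _, by simp⟩)
  · rintro _ ⟨q, hq, rfl⟩
    exact ⟨f * q, mul_mem hf hq, by rw [smul_eq_mul, mul_assoc]⟩

/-- Let `T ⊆ S ⊆ ℝⁿ` with `B(S)` Noetherian and `B(S) ≠ B(T)`, and let
`I` be the vanishing ideal of `S \ T` in `ℝ[x₁,…,xₙ]`. Then any family
`b₁, …, b_m ∈ B(T)` that is algebraically independent over `ℝ` satisfies
`m ≤ Krull dimension of ℝ[x₁,…,xₙ]/I`. -/
theorem trdeg_le_dim_of_noetherian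
    (n : ℕ) (S T : Set (Fin n → ℝ)) (hTS : T ⊆ S)
    (hNoeth : IsNoetherianRing (polyBdd n S))
    (hne : polyBdd n S ≠ polyBdd n T)
    (I : Ideal (MvPolynomial (Fin n) ℝ))
    (hI : ∀ p : MvPolynomial (Fin n) ℝ,
      p ∈ I ↔ ∀ x ∈ S \ T, MvPolynomial.eval x p = 0)
    (m : ℕ) (b : Fin m → MvPolynomial (Fin n) ℝ)
    (hbT : ∀ i, b i ∈ polyBdd n T)
    (hb : AlgebraicIndependent ℝ b) :
    (m : WithBot (WithTop ℕ)) ≤ ringKrullDim (MvPolynomial (Fin n) ℝ ⧸ I) := by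
  have hzero : ∀ g ∈ polyBdd n T, g ∈ I → g = 0 := by
    intro g hgT hgI
    by_contra hg
    refine hne ((polyBdd_anti hTS).antisymm (polyBdd_le_of_mul_mem hTS hg fun f hf => ?_))
    exact mem_polyBdd_of_eval_eq_zero (mul_mem hf hgT) ((hI _).mp (I.mul_mem_left f hgI))
  have hq : AlgebraicIndependent ℝ (fun i => Ideal.Quotient.mkₐ ℝ I (b i)) := by
    rw [algebraicIndependent_iff]
    intro P hP
    rw [← MvPolynomial.comp_aeval_apply] at hP
    have hmem : MvPolynomial.aeval b P ∈ I := Ideal.Quotient.eq_zero_iff_mem.mp hP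
    refine algebraicIndependent_iff.mp hb P (hzero _ ?_ hmem)
    have hP' : MvPolynomial.aeval b P = (MvPolynomial.aeval (fun i => (⟨b i, hbT i⟩ :
        polyBdd n T)) P : polyBdd n T) := by
      rw [← Subalgebra.coe_val, ← AlgHom.comp_apply, MvPolynomial.comp_aeval]
      rfl
    rw [hP']
    exact SetLike.coe_mem _
  exact hq.natCast_le_ringKrullDim
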